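/- Let C be a plane external to the Klein quadric. If M and N are distinct lines of P(V) with M ∥_C N, then M ∩ N = 0; hence every parallel class of ∥_C is a spread of P(V) (a set of pairwise skew lines covering all points). -/

import Mathlib

open ExteriorAlgebra

variable (F : Type*) [Field F] (V : Type*) [AddCommGroup V] [Module F V]

/-- An element of the second exterior power `⋀²V` is decomposable if it is the wedge
`u ∧ v` of two vectors of `V`. -/
def IsDecomposable (x : ⋀[F]^2 V) : Prop :=
  ∃ u v : V, (x : ExteriorAlgebra F V) = ι F u * ι F v

/-- A plane external to the Klein quadric: a 3-dimensional subspace of `⋀²V` containing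
no nonzero decomposable element. -/
def IsExternalPlane (C : Submodule F ↥(⋀[F]^2 V)) : Prop :=
  Module.finrank F C = 3 ∧ ∀ x ∈ C, x ≠ 0 → ¬ IsDecomposable F V x

/-- The Plücker point `γM` of a line `M` of `P(V)`: the subspace of `⋀²V` spanned by all
wedges `u ∧ v` with `u, v ∈ M`.  For a 2-dimensional `M` this is the 1-dimensional
subspace spanned by `u ∧ v`, where `{u, v}` is any basis of `M`. -/
def plueckerPoint (M : Submodule F V) : Submodule F ↥(⋀[F]^2 V) :=
  Submodule.span F {x : ⋀[F]^2 V | ∃ u ∈ M, ∃ v ∈ M, (x : ExteriorAlgebra F V) = ι F u * ι F v}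

/-- The polar `X^⊥` of a subspace `X` of `⋀²V` with respect to the Klein quadric:
all `y` with `x ∧ y = 0` for every `x ∈ X`, the wedge being computed in the
exterior algebra of `V` (it lands in the 1-dimensional space `⋀⁴V`). -/
def polarSubspace (X : Submodule F ↥(⋀[F]^2 V)) : Submodule F ↥(⋀[F]^2 V) where
  carrier := {y | ∀ x ∈ X, (x : ExteriorAlgebra F V) * (y : ExteriorAlgebra F V) = 0}
  add_mem' := by
    intro a b ha hb x hx
    rw [Submodule.coe_add, mul_add, ha x hx, hb x hx, add_zero]
  zero_mem' := by
    intro x hx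
    simp
  smul_mem' := by
    intro c a ha x hx
    rw [Submodule.coe_smul, Algebra.mul_smul_comm, ha x hx, smul_zero]

section Wedge

variable {F V}

/-- The linear map `v ↦ e ∧ v` into the second exterior power. -/
noncomputable def wedgeLeft (e : V) : V →ₗ[F] ⋀[F]^2 V :=
  (LinearMap.mulLeft F (ι F e) ∘ₗ ι F).codRestrict (⋀[F]^2 V) fun v ↦ by
    rw [exteriorPower, pow_two]
    exact Submodule.mul_mem_mul (LinearMap.mem_range_self _ e) (LinearMap.mem_range_self _ v)

@[simp]
lemma coe_wedgeLeft (e v : V) :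
    (wedgeLeft (F := F) e v : ExteriorAlgebra F V) = ι F e * ι F v := rfl

lemma isDecomposable_wedgeLeft (e v : V) : IsDecomposable F V (wedgeLeft e v) := ⟨e, v, rfl⟩

@[simp]
lemma wedgeLeft_self (e : V) : wedgeLeft (F := F) e e = 0 :=
  Subtype.ext (ι_sq_zero e)

lemma wedgeLeft_combination (e m : V) (a b c d : F) :
    wedgeLeft (F := F) (a • e + b • m) (c • e + d • m) = (a * d - b * c) • wedgeLeft e m := by
  apply Subtype.ext
  have h : ι F m * ι F e = -(ι F e * ι F m) := eq_neg_of_add_eq_zero_right (ι_add_mul_swap e m)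
  rw [coe_wedgeLeft, Submodule.coe_smul, coe_wedgeLeft]
  simp only [map_add, map_smul, add_mul, mul_add,
    smul_mul_assoc, mul_smul_comm, ι_sq_zero, h]
  module

lemma wedgeLeft_ne_zero {e v : V} (h : LinearIndependent F ![e, v]) :
    wedgeLeft (F := F) e v ≠ 0 := by
  intro h0
  apply (exteriorPower.ιMulti_family_linearIndependent_field (n := 2) h).ne_zero
    (Set.powersetCard.ofFinEmbEquiv (RelEmbedding.refl _))
  rw [exteriorPower.ιMulti_family, Equiv.symm_apply_apply, ← h0]
  apply Subtype.ext
  simp [ιMulti_apply]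

lemma wedgeLeft_eq_zero_iff {e : V} (he : e ≠ 0) (v : V) :
    wedgeLeft (F := F) e v = 0 ↔ v ∈ Submodule.span F {e} := by
  rw [Submodule.mem_span_singleton]
  constructor
  · intro h
    by_contra hv
    exact wedgeLeft_ne_zero ((LinearIndependent.pair_iff' he).2 (not_exists.1 hv)) h
  · rintro ⟨a, rfl⟩
    simp

lemma ker_wedgeLeft {e : V} (he : e ≠ 0) :
    LinearMap.ker (wedgeLeft (F := F) e) = Submodule.span F {e} :=
  Submodule.ext (wedgeLeft_eq_zero_iff he)

lemma plueckerPoint_span_pair (e m : V) :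
    plueckerPoint F V (Submodule.span F {e, m}) = Submodule.span F {wedgeLeft e m} := by
  apply le_antisymm
  · refine Submodule.span_le.2 ?_
    rintro x ⟨u, hu, v, hv, hx⟩
    obtain ⟨a, b, rfl⟩ := Submodule.mem_span_pair.1 hu
    obtain ⟨c, d, rfl⟩ := Submodule.mem_span_pair.1 hv
    have hx' : x = wedgeLeft (a • e + b • m) (c • e + d • m) := Subtype.ext hx
    rw [hx', wedgeLeft_combination]
    exact Submodule.smul_mem _ _ (Submodule.mem_span_singleton_self _)
  · rw [Submodule.span_singleton_le_iff_mem]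
    exact Submodule.subset_span ⟨e, Submodule.subset_span (by simp), m,
      Submodule.subset_span (by simp), rfl⟩

lemma finrank_span_pair {e m : V} (h : LinearIndependent F ![e, m]) :
    Module.finrank F (Submodule.span F {e, m}) = 2 := by
  rw [← Matrix.range_cons_cons_empty e m ![], finrank_span_eq_card h, Fintype.card_fin]

/-- A nonzero vector of a line extends to a basis of the line. -/
lemma exists_eq_span_pair {M : Submodule F V} (hM : Module.finrank F M = 2) {e : V}
    (he : e ≠ 0) (heM : e ∈ M) :
    ∃ m, LinearIndependent F ![e, m] ∧ M = Submodule.span F {e, m} := by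
  have : FiniteDimensional F M := Module.finite_of_finrank_eq_succ hM
  have hle : Submodule.span F {e} ≤ M := (Submodule.span_singleton_le_iff_mem _ _).2 heM
  obtain ⟨m, hm, hme⟩ : ∃ m ∈ M, m ∉ Submodule.span F {e} := by
    by_contra! h
    have := finrank_span_singleton (K := F) he
    rw [le_antisymm hle h] at this
    omega
  rw [Submodule.mem_span_singleton, not_exists] at hme
  have hli := (LinearIndependent.pair_iff' he).2 hme
  refine ⟨m, hli, (Submodule.eq_of_le_of_finrank_eq ?_ ?_).symm⟩
  · rw [Submodule.span_le]
    rintro x (rfl | rfl) <;> assumption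
  · rw [hM, finrank_span_pair hli]

lemma IsExternalPlane.wedgeLeft_mem_iff {C : Submodule F ↥(⋀[F]^2 V)}
    (hC : IsExternalPlane F V C) (e v : V) : wedgeLeft e v ∈ C ↔ wedgeLeft (F := F) e v = 0 := by
  refine ⟨fun h ↦ ?_, fun h ↦ h ▸ C.zero_mem⟩
  by_contra h0
  exact hC.2 _ h h0 (isDecomposable_wedgeLeft e v)

/-- An external plane is a complement of the space of all `e ∧ v`, for `e ≠ 0`. -/
lemma IsExternalPlane.sup_range_wedgeLeft [FiniteDimensional F V] (hV : Module.finrank F V = 4)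
    {C : Submodule F ↥(⋀[F]^2 V)} (hC : IsExternalPlane F V C) {e : V} (he : e ≠ 0) :
    C ⊔ LinearMap.range (wedgeLeft (F := F) e) = ⊤ := by
  have hinf : C ⊓ LinearMap.range (wedgeLeft (F := F) e) = ⊥ := by
    rw [Submodule.eq_bot_iff]
    rintro x ⟨hx, v, rfl⟩
    exact (hC.wedgeLeft_mem_iff e v).1 hx
  have hsum := Submodule.finrank_sup_add_finrank_inf_eq C (LinearMap.range (wedgeLeft (F := F) e))
  have hrange := LinearMap.finrank_range_add_finrank_ker (wedgeLeft (F := F) e)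
  rw [ker_wedgeLeft he, finrank_span_singleton he, hV] at hrange
  rw [hinf, finrank_bot, hC.1] at hsum
  apply Submodule.eq_top_of_finrank_eq
  have hdim : Module.finrank F (⋀[F]^2 V) = 6 := by
    rw [exteriorPower.finrank_eq, hV]
    rfl
  omega

lemma sup_span_singleton_le_of_sub_mem {W : Type*} [AddCommGroup W] [Module F W]
    {C : Submodule F W} {x y : W} (h : x - y ∈ C) :
    C ⊔ Submodule.span F {x} ≤ C ⊔ Submodule.span F {y} := by
  refine sup_le le_sup_left ((Submodule.span_singleton_le_iff_mem _ _).2 ?_)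
  rw [← sub_add_cancel x y]
  exact Submodule.add_mem_sup h (Submodule.mem_span_singleton_self y)

/-- Parallel lines with a common point coincide. -/
lemma IsExternalPlane.eq_of_mem_of_mem {C : Submodule F ↥(⋀[F]^2 V)}
    (hC : IsExternalPlane F V C) {M N : Submodule F V} (hM : Module.finrank F M = 2)
    (hN : Module.finrank F N = 2) (h : C ⊔ plueckerPoint F V M = C ⊔ plueckerPoint F V N)
    {e : V} (he : e ≠ 0) (heM : e ∈ M) (heN : e ∈ N) : M = N := by
  have : FiniteDimensional F N := Module.finite_of_finrank_eq_succ hN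
  obtain ⟨m, -, rfl⟩ := exists_eq_span_pair hM he heM
  obtain ⟨n, -, rfl⟩ := exists_eq_span_pair hN he heN
  refine Submodule.eq_of_le_of_finrank_eq ?_ (hM.trans hN.symm)
  rw [plueckerPoint_span_pair, plueckerPoint_span_pair] at h
  have hmem : wedgeLeft e m ∈ C ⊔ Submodule.span F {wedgeLeft e n} :=
    h ▸ Submodule.mem_sup_right (Submodule.mem_span_singleton_self _)
  obtain ⟨c, hc, y, hy, hcy⟩ := Submodule.mem_sup.1 hmem
  obtain ⟨a, rfl⟩ := Submodule.mem_span_singleton.1 hy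
  have hdiff : wedgeLeft e (m - a • n) ∈ C := by
    rwa [map_sub, map_smul, ← hcy, add_sub_cancel_right]
  rw [hC.wedgeLeft_mem_iff, wedgeLeft_eq_zero_iff he, Submodule.mem_span_singleton] at hdiff
  obtain ⟨b, hb⟩ := hdiff
  rw [Submodule.span_le]
  rintro x (rfl | rfl)
  · exact heN
  · exact Submodule.mem_span_pair.2 ⟨b, a, by rw [hb, sub_add_cancel]⟩

/-- Through every point there is a line parallel to a given line. -/
lemma IsExternalPlane.exists_parallel_mem [FiniteDimensional F V] (hV : Module.finrank F V = 4)
    {C : Submodule F ↥(⋀[F]^2 V)} (hC : IsExternalPlane F V C) {M : Submodule F V}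
    (hM : Module.finrank F M = 2) {e : V} (he : e ≠ 0) :
    ∃ N : Submodule F V, (Module.finrank F N = 2 ∧
      C ⊔ plueckerPoint F V N = C ⊔ plueckerPoint F V M) ∧ e ∈ N := by
  obtain ⟨x, hxM, hx⟩ := M.exists_mem_ne_zero_of_ne_bot (by rintro rfl; simp at hM)
  obtain ⟨y, hxy, rfl⟩ := exists_eq_span_pair hM hx hxM
  obtain ⟨c, hc, _, ⟨v, rfl⟩, hcv⟩ := Submodule.mem_sup.1
    (hC.sup_range_wedgeLeft hV he ▸ Submodule.mem_top : wedgeLeft x y ∈ _)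
  have hsub : wedgeLeft x y - wedgeLeft e v ∈ C := by rwa [← hcv, add_sub_cancel_right]
  refine ⟨Submodule.span F {e, v}, ⟨finrank_span_pair ?_, ?_⟩, Submodule.subset_span (by simp)⟩
  · refine (LinearIndependent.pair_iff' he).2 fun a ha ↦ wedgeLeft_ne_zero hxy ?_
    rw [← hC.wedgeLeft_mem_iff, ← sub_zero (wedgeLeft x y)]
    rwa [← ha, map_smul, wedgeLeft_self, smul_zero] at hsub
  · rw [plueckerPoint_span_pair, plueckerPoint_span_pair]
    exact le_antisymm (sup_span_singleton_le_of_sub_mem (sub_mem_comm_iff.1 hsub))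
      (sup_span_singleton_le_of_sub_mem hsub)

end Wedge

/-- For a plane `C` external to the Klein quadric, distinct `C`-parallel lines are skew;
hence every parallel class of `∥_C` is a spread (pairwise skew lines covering all points). -/
theorem cParallel_classes_are_spreads
    [FiniteDimensional F V] (hV : Module.finrank F V = 4)
    (C : Submodule F ↥(⋀[F]^2 V)) (hC : IsExternalPlane F V C) :
    (∀ M N : Submodule F V, Module.finrank F M = 2 → Module.finrank F N = 2 →
      M ≠ N → C ⊔ plueckerPoint F V M = C ⊔ plueckerPoint F V N → M ⊓ N = ⊥) ∧
    ∀ M : Submodule F V, Module.finrank F M = 2 →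
      ∀ p : Submodule F V, Module.finrank F p = 1 →
        ∃! N : Submodule F V,
          (Module.finrank F N = 2 ∧ C ⊔ plueckerPoint F V N = C ⊔ plueckerPoint F V M)
            ∧ p ≤ N := by
  refine ⟨fun M N hM hN hne hpar ↦ ?_, fun M hM p hp ↦ ?_⟩
  · by_contra hbot
    obtain ⟨e, ⟨heM, heN⟩, he⟩ := (M ⊓ N).exists_mem_ne_zero_of_ne_bot hbot
    exact hne (hC.eq_of_mem_of_mem hM hN hpar he heM heN)
  · obtain ⟨e, hep, he⟩ := p.exists_mem_ne_zero_of_ne_bot (by rintro rfl; simp at hp)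
    have hspan : p = Submodule.span F {e} :=
      (Submodule.eq_of_le_of_finrank_eq ((Submodule.span_singleton_le_iff_mem _ _).2 hep)
        (by rw [hp, finrank_span_singleton he])).symm
    obtain ⟨N, hN, heN⟩ := hC.exists_parallel_mem hV hM he
    refine ⟨N, ⟨hN, hspan ▸ (Submodule.span_singleton_le_iff_mem _ _).2 heN⟩, ?_⟩
    rintro N' ⟨⟨hN', hpar⟩, hpN'⟩
    exact hC.eq_of_mem_of_mem hN' hN.1 (hpar.trans hN.2.symm) he (hpN' hep) heN
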